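/- Let n ≥ 1, p ≥ 1, t ∈ ℝ, let 𝒮 = (S_0,…,S_{2n}) in 𝕊_p(ℝ), and T_i := Σ_{ℓ=0}^{i} binom(i,ℓ)(−1)^ℓ t^ℓ S_{i−ℓ} for i ∈ {0,…,2n}. Then M_𝒮(n) is block-recursively generated if and only if M_𝒯(n) is block-recursively generated. -/

import Mathlib

open Finset Matrix

/-- The `i`-th block column `X_R^i = col(R_i, …, R_{i+n})` of the moment matrix. -/
def blockCol (n p : ℕ) (R : ℕ → Matrix (Fin p) (Fin p) ℝ) (i : ℕ) :
    Matrix (Fin (n + 1) × Fin p) (Fin p) ℝ :=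
  fun rb c => R (rb.1.1 + i) rb.2 c

/-- The shifted moments `T_i = ∑_{ℓ=0}^{i} C(i,ℓ)(-1)^ℓ t^ℓ S_{i-ℓ}`. -/
def shiftT (p : ℕ) (t : ℝ) (S : ℕ → Matrix (Fin p) (Fin p) ℝ) (i : ℕ) :
    Matrix (Fin p) (Fin p) ℝ :=
  ∑ l ∈ Finset.range (i + 1), ((i.choose l : ℝ) * (-1) ^ l * t ^ l) • S (i - l)

/-- `M_R(n)` is block-recursively generated: every block column relation of degree `< n`
can be multiplied by `x` and stays a block column relation. -/
def BlockRecGen (n p : ℕ) (R : ℕ → Matrix (Fin p) (Fin p) ℝ) : Prop :=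
  ∀ j, j < n → ∀ P : ℕ → Matrix (Fin p) (Fin p) ℝ,
    (∑ i ∈ Finset.range (j + 1), blockCol n p R i * P i) = 0 →
    (∑ i ∈ Finset.range (j + 1), blockCol n p R (i + 1) * P i) = 0

open Polynomial in
/-- The linear functional `ℝ[X] → M_p(ℝ)` sending `X ^ i` to the moment `R i`. -/
noncomputable def momentFunctional {p : ℕ} (R : ℕ → Matrix (Fin p) (Fin p) ℝ) :
    ℝ[X] →ₗ[ℝ] Matrix (Fin p) (Fin p) ℝ :=
  (Polynomial.basisMonomials ℝ).constr ℝ R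

section

open Polynomial

variable {p : ℕ} (R : ℕ → Matrix (Fin p) (Fin p) ℝ)

lemma momentFunctional_X_pow (i : ℕ) : momentFunctional R (X ^ i) = R i := by
  have h := (Polynomial.basisMonomials ℝ).constr_basis ℝ R i
  rw [coe_basisMonomials] at h
  rwa [← monomial_one_right_eq_X_pow]

lemma shiftT_eq_momentFunctional (t : ℝ) (i : ℕ) :
    shiftT p t R i = momentFunctional R ((X - C t) ^ i) := by
  have h : (X - C t : ℝ[X]) ^ i =
      ∑ l ∈ range (i + 1), ((i.choose l : ℝ) * (-1) ^ l * t ^ l) • X ^ (i - l) := by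
    rw [sub_eq_neg_add, add_pow]
    refine sum_congr rfl fun l _ => ?_
    rw [smul_eq_C_mul, neg_pow]
    simp only [map_mul, map_pow, map_neg, map_one, map_natCast]
    ring
  rw [h, map_sum]
  simp only [map_smul, momentFunctional_X_pow, shiftT]

lemma momentFunctional_shiftT (t : ℝ) (q : ℝ[X]) :
    momentFunctional (shiftT p t R) q = momentFunctional R (q.comp (X - C t)) := by
  induction q using Polynomial.induction_on' with
  | add f g hf hg => rw [map_add, add_comp, map_add, hf, hg]
  | monomial i a =>
    rw [← C_mul_X_pow_eq_monomial, ← smul_eq_C_mul, map_smul, smul_comp, map_smul,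
      momentFunctional_X_pow, X_pow_comp, shiftT_eq_momentFunctional]

lemma shiftT_neg_shiftT (t : ℝ) : shiftT p (-t) (shiftT p t R) = R := by
  funext i
  rw [shiftT_eq_momentFunctional, momentFunctional_shiftT]
  simp [momentFunctional_X_pow]

/-- A block column relation says that the moment functional annihilates all the products
of the relation with polynomials of degree at most `n`. -/
lemma sum_blockCol_eq_zero_iff (n s j : ℕ) (P : ℕ → Matrix (Fin p) (Fin p) ℝ) :
    ∑ i ∈ range j, blockCol n p R (i + s) * P i = 0 ↔
      ∀ q : ℝ[X], q.natDegree ≤ n →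
        ∑ i ∈ range j, momentFunctional R (q * X ^ (i + s)) * P i = 0 := by
  have key : ∑ i ∈ range j, blockCol n p R (i + s) * P i = 0 ↔
      ∀ k < n + 1, ∑ i ∈ range j, momentFunctional R (X ^ k * X ^ (i + s)) * P i = 0 := by
    simp only [← pow_add, momentFunctional_X_pow]
    constructor
    · intro h k hk
      ext a b
      have := congrFun (congrFun h (⟨k, hk⟩, a)) b
      simpa [Matrix.sum_apply, Matrix.mul_apply, blockCol] using this
    · intro h
      ext ⟨⟨k, hk⟩, a⟩ b
      have := congrFun (congrFun (h k hk) a) b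
      simpa [Matrix.sum_apply, Matrix.mul_apply, blockCol] using this
  rw [key]
  constructor
  · intro h q hq
    rw [q.as_sum_range_C_mul_X_pow' (Nat.lt_succ_of_le hq)]
    simp only [sum_mul, map_sum, ← smul_eq_C_mul, smul_mul_assoc, map_smul]
    rw [sum_comm]
    refine sum_eq_zero fun k hk => ?_
    rw [← smul_sum, h k (mem_range.mp hk), smul_zero]
  · intro h k hk
    exact h _ ((natDegree_X_pow_le k).trans (Nat.lt_succ_iff.mp hk))

/-- Rewriting a relation in powers of `X - t` as a relation in powers of `X`. -/
lemma sum_momentFunctional_X_sub_C_pow (t : ℝ) (j : ℕ) (q : ℝ[X])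
    (P : ℕ → Matrix (Fin p) (Fin p) ℝ) :
    ∑ i ∈ range j, momentFunctional R (q * (X - C t) ^ i) * P i =
      ∑ m ∈ range j, momentFunctional R (q * X ^ m) *
        ∑ i ∈ range j, ((X - C t) ^ i).coeff m • P i := by
  simp only [mul_sum]
  rw [sum_comm]
  refine sum_congr rfl fun i hi => ?_
  have hdeg : ((X - C t) ^ i).natDegree < j := by
    rw [natDegree_pow, natDegree_X_sub_C, mul_one]
    exact mem_range.mp hi
  conv_lhs => rw [as_sum_range_C_mul_X_pow' ((X - C t) ^ i) hdeg]
  simp only [mul_sum, map_sum, sum_mul, ← smul_eq_C_mul, mul_smul_comm, map_smul,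
    smul_mul_assoc]

lemma BlockRecGen.shiftT {n : ℕ} {R : ℕ → Matrix (Fin p) (Fin p) ℝ}
    (h : BlockRecGen n p R) (t : ℝ) : BlockRecGen n p (shiftT p t R) := by
  intro j hj P hP
  rw [sum_blockCol_eq_zero_iff _ n 1]
  have hP' := (sum_blockCol_eq_zero_iff _ n 0 (j + 1) P).mp hP
  simp only [add_zero, momentFunctional_shiftT, mul_comp, X_pow_comp] at hP' ⊢
  have translated : ∀ q : ℝ[X], q.natDegree ≤ n →
      ∑ i ∈ range (j + 1), momentFunctional R (q * (X - C t) ^ i) * P i = 0 := by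
    intro q hq
    have hc : (q.comp (X + C t)).comp (X - C t) = q := by simp [comp_assoc]
    have := hP' (q.comp (X + C t)) (by rwa [natDegree_comp, natDegree_X_add_C, mul_one])
    rwa [hc] at this
  have hQ := h j hj (fun m => ∑ i ∈ range (j + 1), ((X - C t) ^ i).coeff m • P i) <|
    (sum_blockCol_eq_zero_iff R n 0 (j + 1) _).mpr fun q hq => by
      simpa only [add_zero, sum_momentFunctional_X_sub_C_pow] using translated q hq
  rw [sum_blockCol_eq_zero_iff R n 1] at hQ
  intro q hq
  have hr : (q.comp (X - C t)).natDegree ≤ n := by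
    rwa [natDegree_comp, natDegree_X_sub_C, mul_one]
  generalize q.comp (X - C t) = r at hr
  have hX : ∑ i ∈ range (j + 1), momentFunctional R (r * X * (X - C t) ^ i) * P i = 0 := by
    rw [sum_momentFunctional_X_sub_C_pow]
    simpa only [pow_succ', mul_assoc] using hQ r hr
  have split : ∀ i, r * (X - C t) ^ (i + 1) =
      r * X * (X - C t) ^ i - t • (r * (X - C t) ^ i) := by
    intro i
    rw [smul_eq_C_mul]
    ring
  simp only [split, map_sub, map_smul, sub_mul, smul_mul_assoc, sum_sub_distrib, ← smul_sum]
  rw [hX, translated r hr, smul_zero, sub_zero]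

end

/-- **Proposition 2.7**: `M_𝒮(n)` is block-recursively generated iff `M_𝒯(n)` is. -/
theorem blockRecGen_translation_iff (n p : ℕ) (hn : 1 ≤ n) (hp : 0 < p)
    (S : ℕ → Matrix (Fin p) (Fin p) ℝ) (t : ℝ) :
    BlockRecGen n p S ↔ BlockRecGen n p (shiftT p t S) := by
  refine ⟨fun h => h.shiftT t, fun h => ?_⟩
  simpa only [shiftT_neg_shiftT] using h.shiftT (-t)
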